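/- arXiv:1907.12936 — 2 statements merged into one kernel-verified Lean document; each statement's English description precedes it below -/
import Mathlib

section
/- Fix k ≥ 1. For an integer i and n ≥ 0, let g(i,n) be the number of 4×k matrices (c_{r,s}) with nonnegative integer entries whose entries sum to n and which satisfy Σ_s (c_{1,s} − c_{2,s}) = i. Let K be a field of characteristic zero, let W be a K-vector space of dimension 2, and let GL(W) act on U = End(W)^{⊕k} by simultaneous conjugation. Then for every n ≥ 0, dim (K[U]^{GL(W)})ₙ = g(0,n) − g(1,n). -/
open PowerSeries

/-- The space of `Γ`-invariant homogeneous polynomial functions of degree `n` on `U`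
(for the action `act` of `Γ` on `U`): functions `U → K` which are restrictions to the
diagonal of an `n`-multilinear form (over a field of characteristic zero this is exactly
the degree-`n` homogeneous polynomial functions) and which are invariant under `act`.
This is the `n`-th homogeneous component `(K[U]^Γ)ₙ` of the invariant ring. -/
def invariantPolynomials (K : Type) [Field K] {U Γ : Type} [AddCommGroup U] [Module K U]
    (act : Γ → U → U) (n : ℕ) : Submodule K (U → K) where
  carrier := {F | (∃ m : MultilinearMap K (fun _ : Fin n => U) K, ∀ u, F u = m fun _ => u) ∧
    ∀ γ u, F (act γ u) = F u}
  add_mem' := by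
    rintro F G ⟨⟨mF, hF⟩, hFi⟩ ⟨⟨mG, hG⟩, hGi⟩
    refine ⟨⟨mF + mG, fun u => ?_⟩, fun γ u => ?_⟩
    · simp [hF, hG]
    · simp [Pi.add_apply, hFi γ u, hGi γ u]
  zero_mem' := by
    refine ⟨⟨0, fun u => ?_⟩, fun γ u => rfl⟩
    simp
  smul_mem' := by
    rintro c F ⟨⟨mF, hF⟩, hFi⟩
    refine ⟨⟨c • mF, fun u => ?_⟩, fun γ u => ?_⟩
    · simp [hF]
    · simp [Pi.smul_apply, hFi γ u]

/-- The simultaneous conjugation action of `GL(W)` on `End(W)^{⊕k}`: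
`g · (M₁, …, M_k) = (g M₁ g⁻¹, …, g M_k g⁻¹)`. -/
def conjAction (K : Type) [Field K] (W : Type) [AddCommGroup W] [Module K W] (k : ℕ) :
    (W ≃ₗ[K] W) → (Fin k → W →ₗ[K] W) → (Fin k → W →ₗ[K] W) :=
  fun g M i => g.toLinearMap ∘ₗ M i ∘ₗ g.symm.toLinearMap


/-- `gCount k i n` is the number of `4 × k` matrices with nonnegative integer entries whose
entries sum to `n` and which satisfy `Σ_s (c 0 s − c 1 s) = i`. -/
noncomputable def gCount (k : ℕ) (i : ℤ) (n : ℕ) : ℕ :=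
  Set.ncard {c : Matrix (Fin 4) (Fin k) ℕ |
    (∑ r : Fin 4, ∑ s : Fin k, c r s) = n ∧
    (∑ s : Fin k, ((c 0 s : ℤ) - (c 1 s : ℤ))) = i}

theorem eq_zero_of_raising_lowering {K M : Type*} [Field K] [CharZero K] [AddCommGroup M]
    [Module K M] (A B : M →ₗ[K] M) (V : ℤ → Submodule K M)
    (hA : ∀ i, ∀ v ∈ V i, A v ∈ V (i + 1))
    (hBA : ∀ i, ∀ v ∈ V i, B (A v) = A (B v) - (2 * i : K) • v)
    {N : ℕ} (hV : ∀ i : ℤ, (N : ℤ) < i → V i = ⊥)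
    {w : M} (hw : w ∈ V 1) (h : B (A w) = (-2 : K) • w) : w = 0 := by
  have mem : ∀ j : ℕ, (A ^ j) w ∈ V (j + 1) := by
    intro j
    induction j with
    | zero => simpa using hw
    | succ j ih =>
      rw [pow_succ', Module.End.mul_apply]
      exact_mod_cast hA _ _ ih
  have key : ∀ j : ℕ, B ((A ^ (j + 1)) w) = (-((j + 1) * (j + 2)) : K) • (A ^ j) w := by
    intro j
    induction j with
    | zero => simpa using h
    | succ j ih =>
      rw [pow_succ', Module.End.mul_apply, hBA _ _ (mem (j + 1)), ih, map_smul, pow_succ',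
        Module.End.mul_apply, ← sub_smul]
      congr 1
      push_cast
      ring
  have desc : ∀ j : ℕ, (A ^ j) w = 0 → w = 0 := by
    intro j
    induction j with
    | zero => simp
    | succ j ih =>
      intro h0
      have := key j
      rw [h0, map_zero, eq_comm, smul_eq_zero] at this
      refine ih (this.resolve_left ?_)
      rw [neg_eq_zero]
      exact_mod_cast (by positivity : (j + 1) * (j + 2) ≠ 0)
  refine desc N ?_
  have := mem N
  rwa [hV _ (by omega), Submodule.mem_bot] at this

theorem lowering_eq_zero_of_raising_eq_zero {K M : Type*} [Field K] [CharZero K] [AddCommGroup M]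
    [Module K M] {E F : M →ₗ[K] M} {V : ℤ → Submodule K M}
    (hF : ∀ i, ∀ v ∈ V i, F v ∈ V (i - 1))
    (hEF : ∀ i, ∀ v ∈ V i, E (F v) = F (E v) + (2 * i : K) • v)
    {N : ℕ} (hV : ∀ i : ℤ, (N : ℤ) < |i| → V i = ⊥)
    {v : M} (hv : v ∈ V 0) (h : E v = 0) :
    F v = 0 := by
  refine eq_zero_of_raising_lowering F E (fun i => V (-i)) (fun i v hv => ?_)
    (fun i v hv => ?_) (N := N) (fun i hi => hV _ ?_) (by simpa using hF 0 v hv) ?_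
  · simpa [neg_add, sub_eq_add_neg, add_comm] using hF _ _ hv
  · rw [hEF _ _ hv]; push_cast; module
  · rw [abs_neg]; exact hi.trans_le (le_abs_self i)
  · rw [hEF _ _ (hF 0 v hv), hEF _ _ hv, h]; simp

theorem finrank_inf_ker_add_finrank {K M : Type*} [Field K] [CharZero K] [AddCommGroup M]
    [Module K M] {E F : M →ₗ[K] M} {V : ℤ → Submodule K M}
    (hE : ∀ i, ∀ v ∈ V i, E v ∈ V (i + 1))
    (hF : ∀ i, ∀ v ∈ V i, F v ∈ V (i - 1))
    (hEF : ∀ i, ∀ v ∈ V i, E (F v) = F (E v) + (2 * i : K) • v)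
    {N : ℕ} (hV : ∀ i : ℤ, (N : ℤ) < |i| → V i = ⊥)
    [∀ i, FiniteDimensional K (V i)] :
    Module.finrank K (V 0 ⊓ LinearMap.ker E : Submodule K M) + Module.finrank K (V 1) =
      Module.finrank K (V 0) := by
  have hF' : ∀ v ∈ V 1, F v ∈ V 0 := fun v hv => by simpa using hF 1 v hv
  have hE' : ∀ v ∈ V 0, E v ∈ V 1 := fun v hv => by simpa using hE 0 v hv
  let f : V 1 →ₗ[K] V 0 := F.restrict hF'
  let e : V 0 →ₗ[K] V 1 := E.restrict hE'
  have hinj : Function.Injective (e ∘ₗ f) := by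
    rw [← LinearMap.ker_eq_bot, LinearMap.ker_eq_bot']
    rintro ⟨v, hv⟩ h
    have h : E (F v) = 0 := congrArg Subtype.val h
    refine Subtype.ext (eq_zero_of_raising_lowering E F V hE (fun i v hv => ?_)
      (N := N) (fun i hi => hV _ (hi.trans_le (le_abs_self i))) hv ?_)
    · rw [hEF _ _ hv]; module
    · have := hEF _ _ hv
      rw [h, eq_comm, add_eq_zero_iff_eq_neg] at this
      rw [this]; push_cast; module
  have hsurj : Function.Surjective e := by
    have := LinearMap.injective_iff_surjective.1 hinj
    exact Function.Surjective.of_comp this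
  have hker : LinearMap.ker e = (LinearMap.ker E).comap (V 0).subtype := by
    ext v
    simp [e, Subtype.ext_iff]
  rw [← LinearMap.finrank_range_add_finrank_ker e, LinearMap.range_eq_top.2 hsurj, finrank_top,
    hker, ← Submodule.finrank_map_subtype_eq, Submodule.map_comap_subtype, add_comm]

namespace MvPolynomial

section
variable {σ R M : Type*} [CommRing R] [AddCommMonoid M] {w : σ → M} {m : M}
  {p : MvPolynomial σ R}

theorem IsWeightedHomogeneous.mkDerivation {f : σ → MvPolynomial σ R} {δ : M}
    (hp : IsWeightedHomogeneous w p m) (hf : ∀ i, IsWeightedHomogeneous w (f i) (w i + δ)) :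
    IsWeightedHomogeneous w (mkDerivation R f p) (m + δ) := by
  rw [p.as_sum, map_sum]
  refine .sum _ _ _ fun d hd => ?_
  rw [mkDerivation_monomial, Finsupp.smul_sum]
  refine .sum _ _ _ fun i hi => ?_
  have hd : Finsupp.weight w d = m := hp (mem_support_iff.1 hd)
  have hle : Finsupp.single i 1 ≤ d := by
    rw [Finsupp.single_le_iff]
    exact Nat.one_le_iff_ne_zero.2 (Finsupp.mem_support_iff.1 hi)
  have hm : m + δ = Finsupp.weight w (d - Finsupp.single i 1) + (w i + δ) := by
    rw [← add_assoc, ← hd]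
    conv_lhs => rw [← tsub_add_cancel_of_le hle, map_add, Finsupp.weight_single, one_smul]
  beta_reduce
  rw [hm, smul_eq_C_mul, smul_eq_mul]
  exact ((isWeightedHomogeneous_monomial w _ _ rfl).mul (hf i)).C_mul _

theorem coeff_mkDerivation_smul_X (a : σ → R) (p : MvPolynomial σ R) (d : σ →₀ ℕ) :
    coeff d (MvPolynomial.mkDerivation R (fun j => a j • X j) p) =
      (d.sum fun j k => (k : R) * a j) * coeff d p := by
  induction p using MvPolynomial.induction_on' with
  | monomial e r =>
    have : MvPolynomial.mkDerivation R (fun j => a j • (X j : MvPolynomial σ R)) (monomial e r) =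
        (e.sum fun j k => (k : R) * a j) • monomial e r := by
      rw [mkDerivation_monomial, Finsupp.smul_sum, Finsupp.sum, Finsupp.sum, Finset.sum_smul]
      refine Finset.sum_congr rfl fun i hi => ?_
      have hle : Finsupp.single i 1 ≤ e := by
        rw [Finsupp.single_le_iff]
        exact Nat.one_le_iff_ne_zero.2 (Finsupp.mem_support_iff.1 hi)
      rw [smul_eq_mul, mul_smul_comm, X, monomial_mul, tsub_add_cancel_of_le hle, smul_monomial,
        smul_monomial, smul_monomial]
      congr 1
      simp only [smul_eq_mul]; ring
    classical
    rw [this, coeff_smul, coeff_monomial]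
    split_ifs with h
    · rw [h, smul_eq_mul]
    · simp
  | add p q hp hq => rw [map_add, coeff_add, hp, hq, coeff_add, mul_add]

theorem derivative_aeval (D : Derivation R (MvPolynomial σ R) (MvPolynomial σ R))
    (x : σ → Polynomial R) (hx : ∀ j, Polynomial.derivative (x j) = aeval x (D (X j)))
    (p : MvPolynomial σ R) : Polynomial.derivative (aeval x p) = aeval x (D p) := by
  induction p using MvPolynomial.induction_on with
  | C a => simp
  | add p q hp hq => simp only [map_add, hp, hq]
  | mul_X p j hp =>
    rw [map_mul, Polynomial.derivative_mul, hp, aeval_X, hx, Derivation.leibniz]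
    simp only [map_add, smul_eq_mul, map_mul, aeval_X]
    ring
end

section
variable {σ K : Type*} [Field K]

theorem IsWeightedHomogeneous.eval_zpow_mul [Fintype σ] {M : Type*} [AddCommMonoid M] {w : σ → M}
    {m : M} {p : MvPolynomial σ K} (hp : IsWeightedHomogeneous w p m) (φ : M →+ ℤ) {t : K}
    (ht : t ≠ 0) (x : σ → K) :
    eval (fun j => t ^ φ (w j) * x j) p = t ^ φ m * eval x p := by
  rw [eval_eq', eval_eq', Finset.mul_sum]
  refine Finset.sum_congr rfl fun d hd => ?_
  rw [← hp (mem_support_iff.1 hd), Finsupp.weight_apply, Finsupp.sum_fintype _ _ (by simp)]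
  simp only [mul_pow, Finset.prod_mul_distrib, map_sum, map_nsmul]
  rw [← mul_assoc, mul_comm (coeff d p), mul_assoc]
  congr 1
  have : ∀ s : Finset σ, ∏ i ∈ s, (t ^ φ (w i)) ^ d i = t ^ ∑ i ∈ s, d i • φ (w i) := by
    classical
    intro s
    induction s using Finset.induction_on with
    | empty => simp
    | insert i s hi ih =>
      rw [Finset.prod_insert hi, Finset.sum_insert hi, zpow_add₀ ht, ih, nsmul_eq_mul, mul_comm,
        mul_comm (d i : ℤ), zpow_mul, zpow_natCast, mul_comm]
  exact this _

theorem exists_multilinearMap_of_isHomogeneous {U : Type*} [AddCommGroup U] [Module K U]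
    (ℓ : σ → U →ₗ[K] K) {p : MvPolynomial σ K} {n : ℕ} (hp : p.IsHomogeneous n) :
    ∃ m : MultilinearMap K (fun _ : Fin n => U) K,
      ∀ u, eval (fun j => ℓ j u) p = m fun _ => u := by
  have mono : ∀ d : σ →₀ ℕ, d.degree = n → ∃ m : MultilinearMap K (fun _ : Fin n => U) K,
      ∀ u, (d.prod fun j k => ℓ j u ^ k) = m fun _ => u := by
    rintro d rfl
    have hl : d.degree = d.toMultiset.toList.length := by
      rw [Multiset.length_toList, Finsupp.card_toMultiset]; rfl
    rw [hl]
    refine ⟨(MultilinearMap.mkPiAlgebra K (Fin _) K).compLinearMap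
      fun i => ℓ (d.toMultiset.toList.get i), fun u => ?_⟩
    rw [MultilinearMap.compLinearMap_apply, MultilinearMap.mkPiAlgebra_apply]
    have := Finsupp.prod_toMultiset (d.mapDomain fun j => ℓ j u)
    rw [← Finsupp.toMultiset_map, Finsupp.prod_mapDomain_index (by simp)
      (fun _ _ _ => pow_add _ _ _)] at this
    rw [← this, ← Multiset.coe_toList d.toMultiset, Multiset.map_coe, Multiset.prod_coe,
      Multiset.coe_toList, ← List.prod_ofFn]
    congr 1
    refine List.ext_getElem (by simp) fun i h1 h2 => by simp
  choose! m hm using mono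
  refine ⟨∑ d ∈ p.support, coeff d p • m d, fun u => ?_⟩
  rw [eval_eq, sum_apply]
  refine Finset.sum_congr rfl fun d hd => ?_
  rw [smul_apply, ← hm d, smul_eq_mul]
  · rfl
  · by_contra h
    exact (mem_support_iff.1 hd) (hp.coeff_eq_zero h)

theorem exists_isHomogeneous_of_multilinearMap [Fintype σ] {n : ℕ}
    (m : MultilinearMap K (fun _ : Fin n => σ → K) K) :
    ∃ p : MvPolynomial σ K, p.IsHomogeneous n ∧ ∀ x, eval x p = m fun _ => x := by
  classical
  refine ⟨∑ f : Fin n → σ, C (m fun i => Pi.single (f i) 1) * ∏ i, X (f i),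
    .sum _ _ _ fun f _ => ?_, fun x => ?_⟩
  · have : (∏ i, X (f i) : MvPolynomial σ K).IsHomogeneous (∑ _i : Fin n, 1) :=
      .prod _ _ _ fun i _ => isHomogeneous_X K (f i)
    simpa using (isHomogeneous_C σ _).mul this
  · have hx : x = ∑ j, x j • Pi.single j (1 : K) := pi_eq_sum_univ' x
    conv_rhs => rw [hx, MultilinearMap.map_sum]
    rw [map_sum]
    refine Finset.sum_congr rfl fun f _ => ?_
    rw [MultilinearMap.map_smul_univ, smul_eq_mul, mul_comm]
    simp

theorem derivation_eq_zero_iff_eval_eq [CharZero K]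
    (D : Derivation K (MvPolynomial σ K) (MvPolynomial σ K)) (Γ : (σ → K) → σ → Polynomial K)
    (h0 : ∀ x j, (Γ x j).eval 0 = x j)
    (hΓ : ∀ x j, Polynomial.derivative (Γ x j) = aeval (Γ x) (D (X j))) (p : MvPolynomial σ K) :
    D p = 0 ↔ ∀ t x, eval (fun j => (Γ x j).eval t) p = eval x p := by
  have comp : ∀ t x (q : MvPolynomial σ K),
      eval (fun j => (Γ x j).eval t) q = (aeval (Γ x) q).eval t := by
    intro t x q
    have := comp_aeval_apply (Γ x) (Polynomial.aeval (R := K) t) q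
    simp only [Polynomial.coe_aeval_eq_eval] at this
    rw [← coe_aeval_eq_eval]
    exact this.symm
  have comp0 : ∀ x (q : MvPolynomial σ K), eval x q = (aeval (Γ x) q).eval 0 := by
    intro x q
    simp only [← comp, h0]
  constructor
  · intro hD t x
    have hd : Polynomial.derivative (aeval (Γ x) p) = 0 := by
      rw [derivative_aeval D _ (hΓ x), hD, map_zero]
    rw [comp, comp0, Polynomial.eq_C_of_natDegree_eq_zero (Polynomial.derivative_eq_zero.1 hd)]
    simp
  · intro h
    refine MvPolynomial.funext fun x => ?_
    have hc : aeval (Γ x) p = Polynomial.C (eval x p) := Polynomial.funext fun t => by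
      rw [← comp, h, Polynomial.eval_C]
    rw [comp0, ← derivative_aeval D _ (hΓ x), hc]
    simp

end
end MvPolynomial

section MatrixCoordinates
variable {K : Type*} {k : ℕ}

/-- The matrices with the given coordinates: the coordinates with first index `0`, `1`, `2`, `3`
are the lower left, upper right, upper left and lower right entries. -/
def coordMatrix (x : Fin 4 × Fin k → K) (s : Fin k) : Matrix (Fin 2) (Fin 2) K :=
  !![x (2, s), x (1, s); x (0, s), x (3, s)]

/-- The coordinates of a tuple of matrices, in the order used by `coordMatrix`. -/
def matrixCoord (A : Fin k → Matrix (Fin 2) (Fin 2) K) : Fin 4 × Fin k → K :=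
  fun j => ![A j.2 1 0, A j.2 0 1, A j.2 0 0, A j.2 1 1] j.1

theorem coordMatrix_matrixCoord (A : Fin k → Matrix (Fin 2) (Fin 2) K) :
    coordMatrix (matrixCoord A) = A := by
  ext s i j
  fin_cases i <;> fin_cases j <;> rfl

theorem matrixCoord_coordMatrix (x : Fin 4 × Fin k → K) : matrixCoord (coordMatrix x) = x := by
  ext ⟨r, s⟩
  fin_cases r <;> rfl

variable [Field K]

/-- Simultaneous conjugation by `G`, in coordinates. -/
noncomputable def conjCoord (G : Matrix (Fin 2) (Fin 2) K) (x : Fin 4 × Fin k → K) :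
    Fin 4 × Fin k → K :=
  matrixCoord fun s => G * coordMatrix x s * G⁻¹

theorem conjCoord_mul {A B : Matrix (Fin 2) (Fin 2) K} (x : Fin 4 × Fin k → K) :
    conjCoord (A * B) x = conjCoord A (conjCoord B x) := by
  simp only [conjCoord, coordMatrix_matrixCoord, Matrix.mul_inv_rev, Matrix.mul_assoc]

theorem conjCoord_diagonal {D : Fin 2 → K} (hD : (Matrix.diagonal D).det ≠ 0)
    (x : Fin 4 × Fin k → K) :
    conjCoord (Matrix.diagonal D) x =
      fun j => (D 1 / D 0) ^ (![1, -1, 0, 0] j.1 : ℤ) * x j := by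
  rw [Matrix.det_diagonal, Fin.prod_univ_two, mul_ne_zero_iff] at hD
  obtain ⟨h0, h1⟩ := hD
  have hinv : (Matrix.diagonal D)⁻¹ = Matrix.diagonal fun i => (D i)⁻¹ := by
    refine Matrix.inv_eq_right_inv ?_
    rw [Matrix.diagonal_mul_diagonal, ← Matrix.diagonal_one]
    congr 1
    ext i
    fin_cases i <;> simp [h0, h1]
  ext ⟨r, s⟩
  rw [conjCoord, hinv]
  fin_cases r <;> simp [matrixCoord, coordMatrix] <;> field_simp

theorem conjCoord_transvection_upper (t : K) (x : Fin 4 × Fin k → K) :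
    conjCoord (Matrix.transvection 0 1 t) x = fun j => ![x (0, j.2),
      x (1, j.2) + t * (x (3, j.2) - x (2, j.2)) - t ^ 2 * x (0, j.2),
      x (2, j.2) + t * x (0, j.2), x (3, j.2) - t * x (0, j.2)] j.1 := by
  have hT : ∀ t : K, Matrix.transvection (0 : Fin 2) 1 t = !![1, t; 0, 1] := by
    intro t
    ext i j
    fin_cases i <;> fin_cases j <;> simp [Matrix.transvection]
  have hinv : (Matrix.transvection (0 : Fin 2) 1 t)⁻¹ = !![1, -t; 0, 1] := by
    rw [← hT, Matrix.inv_eq_right_inv]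
    rw [Matrix.transvection_mul_transvection_same _ _ (by decide)]
    simp
  ext ⟨r, s⟩
  rw [conjCoord, hinv, hT]
  fin_cases r <;> simp [matrixCoord, coordMatrix] <;> ring

theorem conjCoord_transvection_lower (t : K) (x : Fin 4 × Fin k → K) :
    conjCoord (Matrix.transvection 1 0 t) x = fun j => ![
      x (0, j.2) + t * (x (2, j.2) - x (3, j.2)) - t ^ 2 * x (1, j.2), x (1, j.2),
      x (2, j.2) - t * x (1, j.2), x (3, j.2) + t * x (1, j.2)] j.1 := by
  have hT : ∀ t : K, Matrix.transvection (1 : Fin 2) 0 t = !![1, 0; t, 1] := by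
    intro t
    ext i j
    fin_cases i <;> fin_cases j <;> simp [Matrix.transvection]
  have hinv : (Matrix.transvection (1 : Fin 2) 0 t)⁻¹ = !![1, 0; -t, 1] := by
    rw [← hT, Matrix.inv_eq_right_inv]
    rw [Matrix.transvection_mul_transvection_same _ _ (by decide)]
    simp
  ext ⟨r, s⟩
  rw [conjCoord, hinv, hT]
  fin_cases r <;> simp [matrixCoord, coordMatrix] <;> ring

end MatrixCoordinates

section WeightSpaces
variable (K : Type*) [Field K] (k : ℕ)

/-- The derivation of the coordinate ring given by conjugation by upper unitriangular matrices. -/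
noncomputable def raisingDerivation :
    Derivation K (MvPolynomial (Fin 4 × Fin k) K) (MvPolynomial (Fin 4 × Fin k) K) :=
  MvPolynomial.mkDerivation K fun j => ![0, MvPolynomial.X (3, j.2) - MvPolynomial.X (2, j.2),
    MvPolynomial.X (0, j.2), -MvPolynomial.X (0, j.2)] j.1

/-- The derivation of the coordinate ring given by conjugation by lower unitriangular matrices. -/
noncomputable def loweringDerivation :
    Derivation K (MvPolynomial (Fin 4 × Fin k) K) (MvPolynomial (Fin 4 × Fin k) K) :=
  MvPolynomial.mkDerivation K fun j => ![MvPolynomial.X (2, j.2) - MvPolynomial.X (3, j.2), 0,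
    -MvPolynomial.X (1, j.2), MvPolynomial.X (1, j.2)] j.1

/-- The degree and the torus weight of a coordinate. -/
def coordWeight (j : Fin 4 × Fin k) : ℕ × ℤ := (1, ![1, -1, 0, 0] j.1)

/-- The homogeneous polynomials of degree `n` and torus weight `i`. -/
noncomputable def weightSpace (n : ℕ) (i : ℤ) : Submodule K (MvPolynomial (Fin 4 × Fin k) K) :=
  MvPolynomial.weightedHomogeneousSubmodule K (coordWeight k) (n, i)

variable {K k}

theorem weight_coordWeight (d : Fin 4 × Fin k →₀ ℕ) :
    Finsupp.weight (coordWeight k) d = (d.degree, d.sum fun j m => (m : ℤ) * ![1, -1, 0, 0] j.1) := by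
  rw [Finsupp.weight_apply, Finsupp.sum_fintype _ _ (by simp), Finsupp.sum_fintype _ _ (by simp),
    Finsupp.degree_eq_sum]
  ext <;> simp [coordWeight, Prod.fst_sum, Prod.snd_sum]

theorem mem_weightSpace_iff {n : ℕ} {i : ℤ} {p : MvPolynomial (Fin 4 × Fin k) K} :
    p ∈ weightSpace K k n i ↔
      MvPolynomial.IsWeightedHomogeneous (coordWeight k) p (n, i) := Iff.rfl

theorem isHomogeneous_of_mem_weightSpace {n : ℕ} {i : ℤ} {p : MvPolynomial (Fin 4 × Fin k) K}
    (hp : p ∈ weightSpace K k n i) : p.IsHomogeneous n := by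
  intro d hd
  have := hp hd
  rw [weight_coordWeight, Prod.mk.injEq] at this
  rw [← this.1, Finsupp.degree_eq_weight_one]
  rfl

theorem raisingDerivation_mem {n : ℕ} (i : ℤ) (p : MvPolynomial (Fin 4 × Fin k) K)
    (hp : p ∈ weightSpace K k n i) : raisingDerivation K k p ∈ weightSpace K k n (i + 1) := by
  have := MvPolynomial.IsWeightedHomogeneous.mkDerivation (δ := ((0, 1) : ℕ × ℤ))
    (mem_weightSpace_iff.1 hp) (f := fun j => ![0, MvPolynomial.X (3, j.2) - MvPolynomial.X (2, j.2),
    MvPolynomial.X (0, j.2), -MvPolynomial.X (0, j.2)] j.1) ?_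
  · exact this
  rintro ⟨r, s⟩
  have hX := fun r : Fin 4 => MvPolynomial.isWeightedHomogeneous_X K (coordWeight k) (r, s)
  fin_cases r
  · exact MvPolynomial.isWeightedHomogeneous_zero K _ _
  · exact (hX 3).sub (hX 2)
  · exact hX 0
  · exact (hX 0).neg

theorem loweringDerivation_mem {n : ℕ} (i : ℤ) (p : MvPolynomial (Fin 4 × Fin k) K)
    (hp : p ∈ weightSpace K k n i) : loweringDerivation K k p ∈ weightSpace K k n (i - 1) := by
  have := MvPolynomial.IsWeightedHomogeneous.mkDerivation (δ := ((0, -1) : ℕ × ℤ))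
    (mem_weightSpace_iff.1 hp) (f := fun j => ![MvPolynomial.X (2, j.2) - MvPolynomial.X (3, j.2), 0,
    -MvPolynomial.X (1, j.2), MvPolynomial.X (1, j.2)] j.1) ?_
  · exact this
  rintro ⟨r, s⟩
  have hX := fun r : Fin 4 => MvPolynomial.isWeightedHomogeneous_X K (coordWeight k) (r, s)
  fin_cases r
  · exact (hX 2).sub (hX 3)
  · exact MvPolynomial.isWeightedHomogeneous_zero K _ _
  · exact (hX 1).neg
  · exact hX 1

theorem lie_raisingDerivation_loweringDerivation :
    ⁅raisingDerivation K k, loweringDerivation K k⁆ = MvPolynomial.mkDerivation K fun j =>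
      (2 * ((![1, -1, 0, 0] j.1 : ℤ) : K)) • MvPolynomial.X j := by
  refine MvPolynomial.derivation_ext fun ⟨r, s⟩ => ?_
  rw [Derivation.commutator_apply]
  fin_cases r <;>
    simp [raisingDerivation, loweringDerivation, MvPolynomial.mkDerivation_X] <;> module

theorem coeff_lie_raisingDerivation_loweringDerivation (p : MvPolynomial (Fin 4 × Fin k) K)
    (d : Fin 4 × Fin k →₀ ℕ) :
    MvPolynomial.coeff d (raisingDerivation K k (loweringDerivation K k p) -
      loweringDerivation K k (raisingDerivation K k p)) =
      2 * ((Finsupp.weight (coordWeight k) d).2 : K) * MvPolynomial.coeff d p := by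
  rw [← Derivation.commutator_apply, lie_raisingDerivation_loweringDerivation,
    MvPolynomial.coeff_mkDerivation_smul_X, weight_coordWeight]
  congr 1
  simp only [Finsupp.sum]
  push_cast
  rw [Finset.mul_sum]
  exact Finset.sum_congr rfl fun j _ => by ring

theorem raisingDerivation_loweringDerivation {n : ℕ} (i : ℤ)
    (p : MvPolynomial (Fin 4 × Fin k) K) (hp : p ∈ weightSpace K k n i) :
    raisingDerivation K k (loweringDerivation K k p) =
      loweringDerivation K k (raisingDerivation K k p) + (2 * i : K) • p := by
  rw [← sub_eq_iff_eq_add']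
  ext d
  rw [coeff_lie_raisingDerivation_loweringDerivation, MvPolynomial.coeff_smul, smul_eq_mul]
  by_cases h : MvPolynomial.coeff d p = 0
  · simp [h]
  · rw [mem_weightSpace_iff.1 hp h]

theorem weightSpace_eq_bot {n : ℕ} (i : ℤ) (hi : (n : ℤ) < |i|) : weightSpace K k n i = ⊥ := by
  rw [eq_bot_iff]
  intro p hp
  ext d
  by_contra h
  have hd := mem_weightSpace_iff.1 hp h
  rw [weight_coordWeight, Prod.mk.injEq] at hd
  refine hi.not_ge ?_
  rw [← hd.1, ← hd.2, Finsupp.degree_apply, Finsupp.sum]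
  push_cast
  refine (Finset.abs_sum_le_sum_abs _ _).trans (Finset.sum_le_sum fun j _ => ?_)
  rw [abs_mul, Nat.abs_cast]
  refine mul_le_of_le_one_right (by positivity) ?_
  obtain ⟨r, s⟩ := j
  fin_cases r <;> simp

theorem finite_setOf_weight_coordWeight_eq (n : ℕ) (i : ℤ) :
    {d : Fin 4 × Fin k →₀ ℕ | Finsupp.weight (coordWeight k) d = (n, i)}.Finite := by
  refine (Set.finite_Iic (Finsupp.equivFunOnFinite.symm fun _ => n)).subset fun d hd j => ?_
  have : d.degree = n := congrArg Prod.fst ((weight_coordWeight d).symm.trans hd)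
  rw [← this]
  exact Finsupp.le_degree j d

theorem weightSpace_eq_restrictSupport (n : ℕ) (i : ℤ) :
    weightSpace K k n i = MvPolynomial.restrictSupport K
      {d | Finsupp.weight (coordWeight k) d = (n, i)} :=
  MvPolynomial.weightedHomogeneousSubmodule_eq_finsupp_supported _ _ _

instance finiteDimensional_weightSpace (n : ℕ) (i : ℤ) :
    FiniteDimensional K (weightSpace K k n i) := by
  rw [weightSpace_eq_restrictSupport]
  have := (finite_setOf_weight_coordWeight_eq (k := k) n i).to_subtype
  exact Module.Finite.of_basis (MvPolynomial.basisRestrictSupport K _)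

theorem finrank_weightSpace (n : ℕ) (i : ℤ) :
    Module.finrank K (weightSpace K k n i) = gCount k i n := by
  rw [weightSpace_eq_restrictSupport,
    Module.finrank_eq_nat_card_basis (MvPolynomial.basisRestrictSupport K _), gCount,
    ← Nat.card_coe_set_eq]
  refine Nat.card_congr ((Finsupp.equivFunOnFinite.trans (Equiv.curry _ _ _)).subtypeEquiv
    fun d => ?_)
  change Finsupp.weight (coordWeight k) d = (n, i) ↔
    (∑ r, ∑ s, d (r, s)) = n ∧ (∑ s, ((d (0, s) : ℤ) - (d (1, s) : ℤ))) = i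
  rw [weight_coordWeight, Prod.mk.injEq,
    Finsupp.degree_eq_sum, Finsupp.sum_fintype _ _ (by simp), Fintype.sum_prod_type,
    Fintype.sum_prod_type]
  refine and_congr Iff.rfl ?_
  rw [Fin.sum_univ_four]
  simp [sub_eq_add_neg, Finset.sum_add_distrib]

end WeightSpaces

section Invariants
variable {K : Type*} [Field K] [CharZero K] {k : ℕ}

theorem raisingDerivation_eq_zero_iff (p : MvPolynomial (Fin 4 × Fin k) K) :
    raisingDerivation K k p = 0 ↔
      ∀ t x, MvPolynomial.eval (conjCoord (Matrix.transvection 0 1 t) x) p =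
        MvPolynomial.eval x p := by
  rw [MvPolynomial.derivation_eq_zero_iff_eval_eq (raisingDerivation K k)
    (fun x j => ![.C (x (0, j.2)), .C (x (1, j.2)) + .X * .C (x (3, j.2) - x (2, j.2)) -
      .X ^ 2 * .C (x (0, j.2)), .C (x (2, j.2)) + .X * .C (x (0, j.2)),
      .C (x (3, j.2)) - .X * .C (x (0, j.2))] j.1)]
  · refine forall₂_congr fun t x => ?_
    rw [conjCoord_transvection_upper]
    refine iff_of_eq (congrArg (fun y => MvPolynomial.eval y p = _) (funext fun ⟨r, s⟩ => ?_))
    fin_cases r <;> simp [mul_comm t, mul_comm (t ^ 2)]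
  · rintro x ⟨r, s⟩
    fin_cases r <;> simp
  · rintro x ⟨r, s⟩
    fin_cases r <;> simp [raisingDerivation, MvPolynomial.mkDerivation_X] <;> ring

theorem loweringDerivation_eq_zero_iff (p : MvPolynomial (Fin 4 × Fin k) K) :
    loweringDerivation K k p = 0 ↔
      ∀ t x, MvPolynomial.eval (conjCoord (Matrix.transvection 1 0 t) x) p =
        MvPolynomial.eval x p := by
  rw [MvPolynomial.derivation_eq_zero_iff_eval_eq (loweringDerivation K k)
    (fun x j => ![.C (x (0, j.2)) + .X * .C (x (2, j.2) - x (3, j.2)) - .X ^ 2 * .C (x (1, j.2)),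
      .C (x (1, j.2)), .C (x (2, j.2)) - .X * .C (x (1, j.2)),
      .C (x (3, j.2)) + .X * .C (x (1, j.2))] j.1)]
  · refine forall₂_congr fun t x => ?_
    rw [conjCoord_transvection_lower]
    refine iff_of_eq (congrArg (fun y => MvPolynomial.eval y p = _) (funext fun ⟨r, s⟩ => ?_))
    fin_cases r <;> simp [mul_comm t, mul_comm (t ^ 2)]
  · rintro x ⟨r, s⟩
    fin_cases r <;> simp
  · rintro x ⟨r, s⟩
    fin_cases r <;> simp [loweringDerivation, MvPolynomial.mkDerivation_X] <;> ring

theorem loweringDerivation_eq_zero {n : ℕ} {p : MvPolynomial (Fin 4 × Fin k) K}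
    (hp : p ∈ weightSpace K k n 0) (h : raisingDerivation K k p = 0) :
    loweringDerivation K k p = 0 :=
  lowering_eq_zero_of_raising_eq_zero (E := (raisingDerivation K k).toLinearMap)
    (F := (loweringDerivation K k).toLinearMap) (V := weightSpace K k n)
    loweringDerivation_mem raisingDerivation_loweringDerivation weightSpace_eq_bot hp h

theorem forall_eval_conjCoord_eq_iff {n : ℕ} {p : MvPolynomial (Fin 4 × Fin k) K}
    (hp : p.IsHomogeneous n) :
    (∀ G : Matrix (Fin 2) (Fin 2) K, G.det ≠ 0 → ∀ x,
      MvPolynomial.eval (conjCoord G x) p = MvPolynomial.eval x p) ↔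
      p ∈ weightSpace K k n 0 ∧ raisingDerivation K k p = 0 := by
  constructor
  · intro h
    have hE : raisingDerivation K k p = 0 :=
      (raisingDerivation_eq_zero_iff p).2 fun t => h _ (by
        rw [Matrix.det_transvection_of_ne _ _ (by decide)]; exact one_ne_zero)
    have hF : loweringDerivation K k p = 0 :=
      (loweringDerivation_eq_zero_iff p).2 fun t => h _ (by
        rw [Matrix.det_transvection_of_ne _ _ (by decide)]; exact one_ne_zero)
    refine ⟨fun d hd => ?_, hE⟩
    have hc := coeff_lie_raisingDerivation_loweringDerivation p d
    rw [hE, hF, map_zero, map_zero, sub_zero, MvPolynomial.coeff_zero, eq_comm, mul_eq_zero] at hc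
    refine Prod.ext ?_ (by simpa using hc.resolve_right hd)
    rw [weight_coordWeight, ← hp hd, Finsupp.degree_eq_weight_one]
    rfl
  · rintro ⟨h0, hE⟩ G hG
    have hF := loweringDerivation_eq_zero h0 hE
    refine Matrix.diagonal_transvection_induction_of_det_ne_zero
      (fun G => ∀ x, MvPolynomial.eval (conjCoord G x) p = MvPolynomial.eval x p) G hG
      (fun D hD x => ?_) (fun t x => ?_) (fun A B _ _ hA hB x => ?_)
    · rw [conjCoord_diagonal hD]
      rw [Matrix.det_diagonal, Fin.prod_univ_two, mul_ne_zero_iff] at hD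
      have := (mem_weightSpace_iff.1 h0).eval_zpow_mul (AddMonoidHom.snd ℕ ℤ)
        (div_ne_zero hD.2 hD.1) x
      simpa [coordWeight] using this
    · obtain ⟨i, j, hij, c⟩ := t
      fin_cases i <;> fin_cases j
      · exact absurd rfl hij
      · exact (raisingDerivation_eq_zero_iff p).1 hE c x
      · exact (loweringDerivation_eq_zero_iff p).1 hF c x
      · exact absurd rfl hij
    · rw [conjCoord_mul, hA, hB]

end Invariants

section Endomorphisms
variable {K W : Type} [Field K] [AddCommGroup W] [Module K W] {k : ℕ}

/-- The coordinates of a tuple of endomorphisms with respect to a basis. -/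
noncomputable def endCoordEquiv (b : Module.Basis (Fin 2) K W) (k : ℕ) :
    (Fin k → W →ₗ[K] W) ≃ₗ[K] (Fin 4 × Fin k → K) where
  toFun M := matrixCoord fun s => LinearMap.toMatrix b b (M s)
  invFun x s := Matrix.toLin b b (coordMatrix x s)
  left_inv M := by simp [coordMatrix_matrixCoord]
  right_inv x := by simp [matrixCoord_coordMatrix]
  map_add' M N := by
    ext ⟨r, s⟩
    fin_cases r <;> simp [matrixCoord]
  map_smul' c M := by
    ext ⟨r, s⟩
    fin_cases r <;> simp [matrixCoord]

theorem endCoordEquiv_conjAction (b : Module.Basis (Fin 2) K W) (g : W ≃ₗ[K] W)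
    (M : Fin k → W →ₗ[K] W) :
    endCoordEquiv b k (conjAction K W k g M) =
      conjCoord (LinearMap.toMatrix b b g) (endCoordEquiv b k M) := by
  have hinv : LinearMap.toMatrix b b g.symm.toLinearMap =
      (LinearMap.toMatrix b b g.toLinearMap)⁻¹ := by
    symm
    refine Matrix.inv_eq_right_inv ?_
    rw [← LinearMap.toMatrix_comp]
    simp
  simp only [endCoordEquiv, conjCoord, conjAction, LinearEquiv.coe_mk, LinearMap.coe_mk,
    AddHom.coe_mk, coordMatrix_matrixCoord, LinearMap.toMatrix_comp b b b, hinv, Matrix.mul_assoc]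

/-- Evaluation of polynomials in the matrix entries as functions on tuples of endomorphisms. -/
noncomputable def evalEnd (b : Module.Basis (Fin 2) K W) (k : ℕ) :
    MvPolynomial (Fin 4 × Fin k) K →ₗ[K] ((Fin k → W →ₗ[K] W) → K) :=
  LinearMap.pi fun M => (MvPolynomial.aeval (endCoordEquiv b k M)).toLinearMap

theorem evalEnd_apply (b : Module.Basis (Fin 2) K W) (p : MvPolynomial (Fin 4 × Fin k) K)
    (M : Fin k → W →ₗ[K] W) :
    evalEnd b k p M = MvPolynomial.eval (endCoordEquiv b k M) p := rfl

variable [CharZero K]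

theorem evalEnd_injective (b : Module.Basis (Fin 2) K W) :
    Function.Injective (evalEnd b k) := by
  intro p q h
  refine MvPolynomial.funext fun x => ?_
  obtain ⟨M, rfl⟩ := (endCoordEquiv b k).surjective x
  exact congrFun h M

theorem evalEnd_conjAction_eq_iff (b : Module.Basis (Fin 2) K W) {n : ℕ}
    {p : MvPolynomial (Fin 4 × Fin k) K} (hp : p.IsHomogeneous n) :
    (∀ g M, evalEnd b k p (conjAction K W k g M) = evalEnd b k p M) ↔
      p ∈ weightSpace K k n 0 ∧ raisingDerivation K k p = 0 := by
  rw [← forall_eval_conjCoord_eq_iff hp]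
  simp only [evalEnd_apply, endCoordEquiv_conjAction]
  constructor
  · intro h G hG x
    obtain ⟨M, rfl⟩ := (endCoordEquiv b k).surjective x
    have hg : LinearMap.toMatrix b b (Matrix.toLinearEquiv b G hG.isUnit).toLinearMap = G :=
      LinearMap.toMatrix_toLin b b G
    rw [← h (Matrix.toLinearEquiv b G hG.isUnit) M, hg]
  · intro h g M
    exact h _ (LinearEquiv.isUnit_det g b b).ne_zero _

theorem invariantPolynomials_conjAction_eq_map (b : Module.Basis (Fin 2) K W) (n : ℕ) :
    invariantPolynomials K (conjAction K W k) n =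
      (weightSpace K k n 0 ⊓ LinearMap.ker (raisingDerivation K k).toLinearMap).map
        (evalEnd b k) := by
  ext f
  constructor
  · rintro ⟨⟨m, hm⟩, hf⟩
    obtain ⟨p, hp, hpm⟩ := MvPolynomial.exists_isHomogeneous_of_multilinearMap
      (m.compLinearMap fun _ => (endCoordEquiv b k).symm.toLinearMap)
    have hpf : evalEnd b k p = f := by
      ext M
      rw [evalEnd_apply, hpm, hm]
      simp
    exact ⟨p, (evalEnd_conjAction_eq_iff b hp).1 (by rwa [hpf]), hpf⟩
  · rintro ⟨p, hp, rfl⟩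
    have hn := isHomogeneous_of_mem_weightSpace hp.1
    exact ⟨MvPolynomial.exists_multilinearMap_of_isHomogeneous
      (fun j => LinearMap.proj (R := K) (φ := fun _ => K) j ∘ₗ (endCoordEquiv b k).toLinearMap) hn,
      (evalEnd_conjAction_eq_iff b hn).2 hp⟩

end Endomorphisms

/-- For `dim W = 2`, the dimension of the `n`-th homogeneous component of
`K[End(W)^{⊕k}]^{GL(W)}` equals `g(0,n) − g(1,n)`. -/
theorem stmt15 (K : Type) [Field K] [CharZero K] (W : Type) [AddCommGroup W] [Module K W]
    (hW : Module.finrank K W = 2) (k : ℕ) (hk : 1 ≤ k) (n : ℕ) :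
    (Module.finrank K (invariantPolynomials K (conjAction K W k) n) : ℤ) =
      (gCount k 0 n : ℤ) - (gCount k 1 n : ℤ) := by
  have : FiniteDimensional K W := FiniteDimensional.of_finrank_pos (by omega)
  let b : Module.Basis (Fin 2) K W := Module.finBasisOfFinrankEq K W hW
  rw [invariantPolynomials_conjAction_eq_map b,
    (Submodule.equivMapOfInjective _ (evalEnd_injective b) _).finrank_eq.symm,
    ← finrank_weightSpace (K := K), ← finrank_weightSpace (K := K), eq_sub_iff_add_eq]
  exact_mod_cast finrank_inf_ker_add_finrank (E := (raisingDerivation K k).toLinearMap)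
    (F := (loweringDerivation K k).toLinearMap) (V := weightSpace K k n)
    raisingDerivation_mem loweringDerivation_mem raisingDerivation_loweringDerivation
    weightSpace_eq_bot
end

section
/- Let K be a field of characteristic zero, let W be a K-vector space of dimension 2, and let GL(W) act on U = End(W) ⊕ End(W) (pairs of endomorphisms) by simultaneous conjugation g·(M₁,M₂) = (gM₁g⁻¹, gM₂g⁻¹). Then the Hilbert series of the invariant ring K[U]^{GL(W)} equals 1/((1−x²)³(1−x)²). -/
open PowerSeries

/-- `F` is the restriction to the diagonal of an `n`-multilinear form. -/
def IsDiagonalForm (K : Type) [Field K] {U : Type} [AddCommGroup U] [Module K U] (n : ℕ)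
    (F : U → K) : Prop :=
  ∃ m : MultilinearMap K (fun _ : Fin n => U) K, ∀ u, F u = m fun _ => u

namespace IsDiagonalForm

variable {K : Type} [Field K] {U V : Type} [AddCommGroup U] [Module K U]
  [AddCommGroup V] [Module K V] {n k : ℕ} {F G : U → K}

theorem comp (hF : IsDiagonalForm K n F) (φ : V →ₗ[K] U) :
    IsDiagonalForm K n fun v => F (φ v) := by
  obtain ⟨m, hm⟩ := hF
  exact ⟨m.compLinearMap fun _ => φ, fun v => by simp [hm]⟩

theorem of_linear (φ : U →ₗ[K] K) : IsDiagonalForm K 1 fun u => φ u :=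
  ⟨(MultilinearMap.mkPiAlgebra K (Fin 1) K).compLinearMap fun _ => φ, fun u => by simp⟩

theorem one : IsDiagonalForm K 0 fun _ : U => (1 : K) :=
  ⟨MultilinearMap.constOfIsEmpty K _ 1, fun u => by simp⟩

theorem add (hF : IsDiagonalForm K n F) (hG : IsDiagonalForm K n G) :
    IsDiagonalForm K n fun u => F u + G u := by
  obtain ⟨a, ha⟩ := hF
  obtain ⟨b, hb⟩ := hG
  exact ⟨a + b, fun u => by simp [ha, hb]⟩

theorem sub (hF : IsDiagonalForm K n F) (hG : IsDiagonalForm K n G) :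
    IsDiagonalForm K n fun u => F u - G u := by
  obtain ⟨a, ha⟩ := hF
  obtain ⟨b, hb⟩ := hG
  exact ⟨a - b, fun u => by simp [ha, hb]⟩

theorem mul (hF : IsDiagonalForm K n F) (hG : IsDiagonalForm K k G) :
    IsDiagonalForm K (n + k) fun u => F u * G u := by
  obtain ⟨a, ha⟩ := hF
  obtain ⟨b, hb⟩ := hG
  exact ⟨((LinearMap.mul' K K).compMultilinearMap (a.domCoprod b)).domDomCongr finSumFinEquiv,
    fun u => by simp [ha, hb, MultilinearMap.domCoprod_apply]⟩

theorem pow (hF : IsDiagonalForm K n F) (k : ℕ) :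
    IsDiagonalForm K (n * k) fun u => F u ^ k := by
  induction k with
  | zero => simpa using one
  | succ k ih => simpa only [pow_succ, mul_add_one] using ih.mul hF

theorem map_smul (hF : IsDiagonalForm K n F) (c : K) (u : U) : F (c • u) = c ^ n * F u := by
  obtain ⟨m, hm⟩ := hF
  simp only [hm]
  simpa using m.map_smul_univ (fun _ => c) (fun _ => u)

theorem exists_mvPolynomial (hF : IsDiagonalForm K n F) (e : Fin k → U) :
    ∃ f : MvPolynomial (Fin k) K, ∀ z, MvPolynomial.eval z f = F (∑ i, z i • e i) := by
  obtain ⟨m, hm⟩ := hF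
  refine ⟨∑ r : Fin n → Fin k,
    (∏ j, MvPolynomial.X (r j)) * MvPolynomial.C (m fun j => e (r j)), fun z => ?_⟩
  rw [hm, m.map_sum]
  simp only [map_sum, map_mul, map_prod, MvPolynomial.eval_X, MvPolynomial.eval_C]
  refine Finset.sum_congr rfl fun r _ => ?_
  exact (m.map_smul_univ (fun j => z (r j)) (fun j => e (r j))).symm

theorem eq_zero_on_line (hF : IsDiagonalForm K n F) (u v : U) {h : ℕ → K}
    (hh : Function.Injective h) (h0 : ∀ j, F (u + h j • v) = 0) (z : K) : F (u + z • v) = 0 := by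
  obtain ⟨f, hf⟩ := hF.exists_mvPolynomial ![u, v]
  have key : ∀ z : K, (MvPolynomial.aeval ![(1 : Polynomial K), Polynomial.X] f).eval z =
      F (u + z • v) := by
    intro z
    have h1 := hf ![1, z]
    simp only [Fin.sum_univ_two, Matrix.cons_val_zero, Matrix.cons_val_one, one_smul] at h1
    rw [← h1, ← Polynomial.coe_evalRingHom, MvPolynomial.aeval_def, MvPolynomial.hom_eval₂]
    have h2 : (Polynomial.evalRingHom z).comp (algebraMap K (Polynomial K)) = RingHom.id K := by
      ext; simp
    rw [h2, MvPolynomial.eval, MvPolynomial.coe_eval₂Hom]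
    congr 1
    ext i
    fin_cases i <;> simp
  have hroots : ∀ j, h j ∈
      {z | (MvPolynomial.aeval ![(1 : Polynomial K), Polynomial.X] f).IsRoot z} := fun j => by
    rw [Set.mem_ofPred_eq, Polynomial.IsRoot.def, key, h0]
  rw [← key, Polynomial.eq_zero_of_infinite_isRoot _
    (Set.infinite_of_injective_forall_mem hh hroots), Polynomial.eval_zero]

end IsDiagonalForm

theorem MvPolynomial.coeff_aeval_C_mul_X {K σ : Type} [Field K] (a : σ → K)
    (f : MvPolynomial σ K) (d : σ →₀ ℕ) :
    (MvPolynomial.aeval (fun i => MvPolynomial.C (a i) * MvPolynomial.X i) f).coeff d =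
      (d.prod fun i k => a i ^ k) * f.coeff d := by
  classical
  induction f using MvPolynomial.induction_on' with
  | monomial e c =>
    have : MvPolynomial.aeval (fun i => MvPolynomial.C (a i) * MvPolynomial.X i)
        (MvPolynomial.monomial e c) =
        MvPolynomial.monomial e ((e.prod fun i k => a i ^ k) * c) := by
      rw [MvPolynomial.aeval_monomial, MvPolynomial.monomial_eq, map_mul, 
        mul_comm _ (MvPolynomial.C c),
        mul_assoc, MvPolynomial.algebraMap_eq]
      congr 1
      simp [Finsupp.prod, mul_pow, Finset.prod_mul_distrib]
    rw [this, MvPolynomial.coeff_monomial, MvPolynomial.coeff_monomial]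
    split_ifs with h
    · rw [h]
    · simp
  | add p q hp hq => rw [map_add, MvPolynomial.coeff_add, hp, hq, MvPolynomial.coeff_add, mul_add]

theorem MvPolynomial.prod_scale_eq_of_coeff_ne_zero {K : Type} [Field K] [Infinite K] {k : ℕ}
    (f : MvPolynomial (Fin k) K) (a : Fin k → K) (c : K)
    (h : ∀ z, MvPolynomial.eval (fun i => a i * z i) f = c * MvPolynomial.eval z f)
    {d : Fin k →₀ ℕ} (hd : f.coeff d ≠ 0) : ∏ i, a i ^ d i = c := by
  have h1 : MvPolynomial.aeval (fun i => MvPolynomial.C (a i) * MvPolynomial.X i) f =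
      MvPolynomial.C c * f := by
    refine MvPolynomial.funext fun z => ?_
    rw [map_mul, MvPolynomial.eval_C, ← h, MvPolynomial.aeval_def, MvPolynomial.hom_eval₂,
      MvPolynomial.eval, MvPolynomial.coe_eval₂Hom]
    congr 1
    · ext; simp
    · ext; simp
  have h2 := congrArg (MvPolynomial.coeff d) h1
  rw [MvPolynomial.coeff_aeval_C_mul_X, MvPolynomial.coeff_C_mul,
    Finsupp.prod_fintype _ _ (by simp)] at h2
  exact mul_right_cancel₀ hd h2

/-- Pairs of `2 × 2` matrices. -/
abbrev MatPair (K : Type) : Type := Matrix (Fin 2) (Fin 2) K × Matrix (Fin 2) (Fin 2) K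

/-- Simultaneous conjugation on pairs of `2 × 2` matrices. -/
def matConj (K : Type) [Field K] (g : GL (Fin 2) K) (u : MatPair K) : MatPair K :=
  (g.val * u.1 * g⁻¹.val, g.val * u.2 * g⁻¹.val)

theorem finrank_invariantPolynomials_congr {K U V Γ Δ : Type} [Field K]
    [AddCommGroup U] [Module K U] [AddCommGroup V] [Module K V]
    (act : Γ → U → U) (actV : Δ → V → V) (φ : U ≃ₗ[K] V) (e : Γ ≃ Δ)
    (h : ∀ γ u, φ (act γ u) = actV (e γ) (φ u)) (n : ℕ) :
    Module.finrank K (invariantPolynomials K act n) =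
      Module.finrank K (invariantPolynomials K actV n) := by
  have hmap : invariantPolynomials K actV n =
      (invariantPolynomials K act n).map (LinearEquiv.funCongrLeft K K φ.symm).toLinearMap := by
    ext F
    rw [Submodule.mem_map_equiv]
    constructor
    · rintro ⟨hF, hi⟩
      refine ⟨IsDiagonalForm.comp (n := n) hF φ.toLinearMap, fun γ u => ?_⟩
      change F (φ (act γ u)) = F (φ u)
      rw [h, hi]
    · rintro ⟨hF, hi⟩
      have hFφ := IsDiagonalForm.comp (n := n) hF φ.symm.toLinearMap
      have key : ∀ u, F u = F (φ (φ.symm u)) := fun u => by simp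
      refine ⟨?_, fun γ u => ?_⟩
      · obtain ⟨m, hm⟩ := hFφ
        exact ⟨m, fun u => (key u).trans (hm u)⟩
      · have h1 := hi (e.symm γ) (φ.symm u)
        change F (φ _) = F (φ _) at h1
        simpa [h] using h1
  rw [hmap]
  exact (LinearEquiv.finrank_map_eq _ _).symm

theorem finrank_conjAction_eq {K : Type} [Field K] {W : Type} [AddCommGroup W] [Module K W]
    (hW : Module.finrank K W = 2) (n : ℕ) :
    Module.finrank K (invariantPolynomials K (conjAction K W 2) n) =
      Module.finrank K (invariantPolynomials K (matConj K) n) := by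
  have : Module.Finite K W := Module.finite_of_finrank_pos (by omega)
  let b := Module.finBasisOfFinrankEq K W hW
  let t := LinearMap.toMatrixAlgEquiv b
  refine finrank_invariantPolynomials_congr _ _
    (LinearEquiv.finTwoArrow K (W →ₗ[K] W) ≪≫ₗ t.toLinearEquiv.prodCongr t.toLinearEquiv)
    ((LinearMap.GeneralLinearGroup.generalLinearEquiv K W).symm.toEquiv.trans
      (Units.mapEquiv t.toMulEquiv).toEquiv) (fun γ u => ?_) n
  have key : ∀ i, t (conjAction K W 2 γ u i) = t γ.toLinearMap * t (u i) * t γ.symm.toLinearMap := by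
    intro i
    rw [← map_mul, ← map_mul, mul_assoc]
    rfl
  exact Prod.ext (key 0) (key 1)

section Matrices

variable {K : Type} [Field K]

theorem invariant_eq_of_intertwine {n : ℕ} {F : MatPair K → K}
    (hF : F ∈ invariantPolynomials K (matConj K) n) (P : Matrix (Fin 2) (Fin 2) K)
    (hP : P.det ≠ 0) (u v : MatPair K) (h1 : u.1 * P = P * v.1) (h2 : u.2 * P = P * v.2) :
    F u = F v := by
  rw [← hF.2 (Matrix.GeneralLinearGroup.mkOfDetNeZero P hP) v]
  have hinv : P * (Matrix.GeneralLinearGroup.mkOfDetNeZero P hP)⁻¹.val = 1 :=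
    (Matrix.GeneralLinearGroup.mkOfDetNeZero P hP).mul_inv
  congr 1
  refine Prod.ext ?_ ?_
  · change u.1 = P * v.1 * _
    rw [← h1, mul_assoc, hinv, mul_one]
  · change u.2 = P * v.2 * _
    rw [← h2, mul_assoc, hinv, mul_one]

/-- The linear family of pairs of matrices whose trace-free parts are antidiagonal. -/
def antidiagBasis (K : Type) [Field K] : Fin 6 → MatPair K :=
  ![(1, 0), (0, 1), (!![0, 1; 0, 0], 0), (!![0, 0; 1, 0], 0), (0, !![0, 1; 0, 0]),
    (0, !![0, 0; 1, 0])]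

theorem sum_antidiagBasis (z : Fin 6 → K) : ∑ i, z i • antidiagBasis K i =
    (!![z 0, z 2; z 3, z 0], !![z 1, z 4; z 5, z 1]) := by
  simp only [Fin.sum_univ_six, antidiagBasis]
  ext i j <;> fin_cases i <;> fin_cases j <;> simp

variable [CharZero K]

theorem injective_mul_sq_add (c c₀ : K) (hc : c ≠ 0) :
    Function.Injective fun j : ℕ => c * ((j : K) + 1) ^ 2 + c₀ := by
  intro i j h
  have h1 : ((i : K) + 1) ^ 2 = ((j : K) + 1) ^ 2 := mul_left_cancel₀ hc (add_right_cancel h)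
  have h2 : (i + 1) ^ 2 = (j + 1) ^ 2 := by exact_mod_cast h1
  have h3 := Nat.pow_left_injective two_ne_zero h2
  omega

theorem injective_cast_add_one : Function.Injective fun j : ℕ => (j : K) + 1 := by
  intro i j h
  exact Nat.cast_injective (add_right_cancel h)

theorem invariant_eq_zero_of_diagonal {n : ℕ} {F : MatPair K → K}
    (hF : F ∈ invariantPolynomials K (matConj K) n)
    (h0 : ∀ a b x y t s : K, F (!![a, x; y, a], !![b, t; s, b]) = 0) (a₁ a₂ b₁ b₂ x y : K) :
    F (!![a₁, 0; 0, a₂], !![b₁, x; y, b₂]) = 0 := by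
  have hD : IsDiagonalForm K n F := hF.1
  have step1 : ∀ y w : K, w ≠ 0 → F (!![a₁, 0; 0, a₂], !![b₁, -y * w ^ 2; y, b₂]) = 0 := by
    intro y w hw
    rw [invariant_eq_of_intertwine hF !![w, -w; 1, 1] (by
      rw [Matrix.det_fin_two_of]; ring_nf; exact mul_ne_zero hw two_ne_zero) _
      (!![(a₁ + a₂) / 2, (a₂ - a₁) / 2; (a₂ - a₁) / 2, (a₁ + a₂) / 2],
       !![(b₁ + b₂) / 2, (b₂ - b₁) / 2 - y * w; (b₂ - b₁) / 2 + y * w, (b₁ + b₂) / 2]) ?_ ?_]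
    · exact h0 _ _ _ _ _ _
    · ext i j; fin_cases i <;> fin_cases j <;> simp [Matrix.mul_apply] <;> ring
    · ext i j; fin_cases i <;> fin_cases j <;> simp [Matrix.mul_apply] <;> ring
  have step2 : ∀ x y : K, y ≠ 0 → F (!![a₁, 0; 0, a₂], !![b₁, x; y, b₂]) = 0 := by
    intro x y hy
    have h := hD.eq_zero_on_line (!![a₁, 0; 0, a₂], !![b₁, 0; y, b₂]) (0, !![0, 1; 0, 0])
      (injective_mul_sq_add (-y) 0 (neg_ne_zero.mpr hy)) (fun j => ?_) x
    · simpa using h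
    · simpa using step1 y (j + 1) (Nat.cast_add_one_ne_zero j)
  have h := hD.eq_zero_on_line (!![a₁, 0; 0, a₂], !![b₁, x; 0, b₂]) (0, !![0, 0; 1, 0])
    injective_cast_add_one (fun j => ?_) y
  · simpa using h
  · simpa using step2 x (j + 1) (Nat.cast_add_one_ne_zero j)

theorem invariant_eq_zero {n : ℕ} {F : MatPair K → K}
    (hF : F ∈ invariantPolynomials K (matConj K) n)
    (h0 : ∀ a b x y t s : K, F (!![a, x; y, a], !![b, t; s, b]) = 0) : F = 0 := by
  have hD : IsDiagonalForm K n F := hF.1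
  have hdiag : ∀ (a₁ a₂ : K) (B : Matrix (Fin 2) (Fin 2) K), F (!![a₁, 0; 0, a₂], B) = 0 := by
    intro a₁ a₂ B
    rw [Matrix.eta_fin_two B]
    exact invariant_eq_zero_of_diagonal hF h0 _ _ _ _ _ _
  have step1 : ∀ (p r s w : K) (B : Matrix (Fin 2) (Fin 2) K), r ≠ 0 → w ≠ 0 →
      F (!![p, (w ^ 2 - (p - s) ^ 2) / (4 * r); r, s], B) = 0 := by
    intro p r s w B hr hw
    have hP : (!![(p - s + w) / 2, (p - s - w) / 2; r, r]).det ≠ 0 := by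
      rw [Matrix.det_fin_two_of]
      ring_nf
      exact mul_ne_zero hw hr
    rw [invariant_eq_of_intertwine hF _ hP _ (!![(p + s + w) / 2, 0; 0, (p + s - w) / 2],
      (!![(p - s + w) / 2, (p - s - w) / 2; r, r])⁻¹ * (B *
        !![(p - s + w) / 2, (p - s - w) / 2; r, r])) ?_ ?_]
    · exact hdiag _ _ _
    · ext i j; fin_cases i <;> fin_cases j <;> simp [Matrix.mul_apply] <;> field_simp <;> ring
    · rw [Matrix.mul_nonsing_inv_cancel_left _ _ (isUnit_iff_ne_zero.mpr hP)]
  have step2 : ∀ (p q r s : K) (B : Matrix (Fin 2) (Fin 2) K), r ≠ 0 →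
      F (!![p, q; r, s], B) = 0 := by
    intro p q r s B hr
    have h := hD.eq_zero_on_line (!![p, 0; r, s], B) (!![0, 1; 0, 0], 0)
      (injective_mul_sq_add (1 / (4 * r)) (-(p - s) ^ 2 / (4 * r)) (by simpa using hr))
      (fun j => ?_) q
    · simpa using h
    · have h := step1 p r s (j + 1) B hr (Nat.cast_add_one_ne_zero j)
      have h2 : (((j : K) + 1) ^ 2 - (p - s) ^ 2) / (4 * r) =
          1 / (4 * r) * ((j : K) + 1) ^ 2 + -(p - s) ^ 2 / (4 * r) := by ring
      rw [h2] at h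
      simpa using h
  funext u
  obtain ⟨A, B⟩ := u
  rw [Matrix.eta_fin_two A]
  have h := hD.eq_zero_on_line (!![A 0 0, A 0 1; 0, A 1 1], B) (!![0, 0; 1, 0], 0)
    injective_cast_add_one (fun j => ?_) (A 1 0)
  · simpa using h
  · simpa using step2 (A 0 0) (A 0 1) (j + 1) (A 1 1) B (Nat.cast_add_one_ne_zero j)

end Matrices

/-- Exponents of the monomials of degree `n` in five variables in which the last three
variables have even exponents. -/
def evenExponents (n : ℕ) : Finset (Fin 5 →₀ ℕ) :=
  (Finset.finsuppAntidiag Finset.univ n).filter fun l => Even (l 2) ∧ Even (l 3) ∧ Even (l 4)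

theorem mem_evenExponents {n : ℕ} {l : Fin 5 →₀ ℕ} : l ∈ evenExponents n ↔
    l 0 + l 1 + l 2 + l 3 + l 4 = n ∧ Even (l 2) ∧ Even (l 3) ∧ Even (l 4) := by
  simp [evenExponents, Finset.mem_finsuppAntidiag, Fin.sum_univ_five]

theorem mk_card_evenExponents_mul :
    (PowerSeries.mk fun n => ((evenExponents n).card : ℤ)) *
      ((1 - X ^ 2) ^ 3 * (1 - X) ^ 2) = 1 := by
  let g₁ : PowerSeries ℤ := PowerSeries.mk 1
  let g₂ : PowerSeries ℤ := PowerSeries.mk fun n => if Even n then 1 else 0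
  have h1 : g₁ * (1 - X) = 1 := PowerSeries.mk_one_mul_one_sub_eq_one ℤ
  have h2 : g₂ * (1 - X ^ 2) = 1 := by
    ext n
    rw [mul_sub, mul_one, map_sub, PowerSeries.coeff_mul_X_pow', PowerSeries.coeff_one]
    simp only [g₂, PowerSeries.coeff_mk]
    rcases n with _ | _ | n
    · simp
    · simp
    · simp [Nat.even_add]
  have h3 : (PowerSeries.mk fun n => ((evenExponents n).card : ℤ)) =
      ∏ i : Fin 5, ![g₁, g₁, g₂, g₂, g₂] i := by
    ext n
    rw [PowerSeries.coeff_prod, PowerSeries.coeff_mk, evenExponents, Finset.card_filter,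
      Nat.cast_sum]
    refine Finset.sum_congr rfl fun l _ => ?_
    simp only [Fin.prod_univ_five, g₁, g₂]
    by_cases h2 : Even (l 2) <;> by_cases h3 : Even (l 3) <;> by_cases h4 : Even (l 4) <;>
      simp [h2, h3, h4]
  rw [h3]
  simp only [Fin.prod_univ_five, Matrix.cons_val]
  calc _ = (g₁ * (1 - X)) ^ 2 * (g₂ * (1 - X ^ 2)) ^ 3 := by ring
    _ = 1 := by rw [h1, h2]; simp

/-- Linearly in the invariant, its restriction to the span of `antidiagBasis` is a polynomial. -/
theorem exists_restrictionPolynomial (K : Type) [Field K] [CharZero K] (n : ℕ) :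
    ∃ L : invariantPolynomials K (matConj K) n →ₗ[K] MvPolynomial (Fin 6) K,
      ∀ F z, MvPolynomial.eval z (L F) = F.1 (∑ i, z i • antidiagBasis K i) := by
  let E : MvPolynomial (Fin 6) K →ₗ[K] ((Fin 6 → K) → K) :=
    { toFun := fun f z => MvPolynomial.eval z f
      map_add' := fun f g => by ext; simp
      map_smul' := fun c f => by ext; simp [MvPolynomial.smul_eval] }
  have hE : Function.Injective E := fun f g h => MvPolynomial.funext fun z => congrFun h z
  let R : invariantPolynomials K (matConj K) n →ₗ[K] ((Fin 6 → K) → K) :=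
    { toFun := fun F z => F.1 (∑ i, z i • antidiagBasis K i)
      map_add' := fun F G => rfl
      map_smul' := fun c F => rfl }
  have hR : ∀ F, R F ∈ LinearMap.range E := by
    intro F
    obtain ⟨f, hf⟩ := IsDiagonalForm.exists_mvPolynomial (n := n) F.2.1 (antidiagBasis K)
    exact ⟨f, funext hf⟩
  refine ⟨(LinearEquiv.ofInjective E hE).symm.toLinearMap ∘ₗ R.codRestrict _ hR, fun F z => ?_⟩
  have h := (LinearEquiv.ofInjective E hE).apply_symm_apply (R.codRestrict _ hR F)
  exact congrFun (congrArg Subtype.val h) z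

/-- The exponent of the monomial `s ^ l₀ t ^ l₁ (x₁x₂) ^ (l₂/2) (y₁y₂) ^ (l₃/2) (x₁y₂) ^ (l₄/2)`. -/
noncomputable def leadingExponent (l : Fin 5 →₀ ℕ) : Fin 6 →₀ ℕ :=
  Finsupp.equivFunOnFinite.symm
    ![l 0, l 1, l 2 / 2 + l 4 / 2, l 2 / 2, l 3 / 2, l 3 / 2 + l 4 / 2]

theorem exists_leadingExponent_eq {n : ℕ} (d : Fin 6 →₀ ℕ)
    (h1 : d 0 + d 1 + d 2 + d 3 + d 4 + d 5 = n) (h2 : d 2 + d 4 = d 3 + d 5) (h3 : d 3 ≤ d 2) :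
    ∃ l ∈ evenExponents n, leadingExponent l = d := by
  refine ⟨Finsupp.equivFunOnFinite.symm ![d 0, d 1, 2 * d 3, 2 * d 4, 2 * (d 2 - d 3)], ?_, ?_⟩
  · rw [mem_evenExponents]
    simp
    omega
  · ext i
    fin_cases i <;> simp [leadingExponent] <;> omega

theorem exists_injective_coefficients (K : Type) [Field K] [CharZero K] (n : ℕ) :
    ∃ T : invariantPolynomials K (matConj K) n →ₗ[K] (evenExponents n → K),
      Function.Injective T := by
  obtain ⟨L, hL⟩ := exists_restrictionPolynomial K n
  refine ⟨LinearMap.pi fun l => MvPolynomial.lcoeff K (leadingExponent l.1) ∘ₗ L, ?_⟩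
  rw [← LinearMap.ker_eq_bot, LinearMap.ker_eq_bot']
  intro F hFT
  have hcoeff : ∀ l ∈ evenExponents n, (L F).coeff (leadingExponent l) = 0 :=
    fun l hl => congrFun hFT ⟨l, hl⟩
  have hD : IsDiagonalForm K n F.1 := F.2.1
  simp only [sum_antidiagBasis] at hL
  have two_pow : ∀ {a b : ℕ}, (2 : K) ^ a = 2 ^ b → a = b := by
    intro a b h
    exact Nat.pow_right_injective le_rfl (by exact_mod_cast h)
  have hdeg : ∀ d, (L F).coeff d ≠ 0 → d 0 + d 1 + d 2 + d 3 + d 4 + d 5 = n := by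
    intro d hd
    have h := MvPolynomial.prod_scale_eq_of_coeff_ne_zero (L F) (fun _ => 2) (2 ^ n)
      (fun z => ?_) hd
    · rw [Finset.prod_pow_eq_pow_sum, Fin.sum_univ_six] at h
      exact two_pow h
    · rw [hL, hL, ← hD.map_smul]
      simp
  have htor : ∀ d, (L F).coeff d ≠ 0 → d 0 + d 1 + 2 * d 2 + 2 * d 4 = n := by
    intro d hd
    have h := MvPolynomial.prod_scale_eq_of_coeff_ne_zero (L F) ![2, 2, 4, 1, 4, 1] (2 ^ n)
      (fun z => ?_) hd
    · apply two_pow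
      rw [← h]
      have h4 : (4 : K) = 2 ^ 2 := by norm_num
      simp only [Fin.prod_univ_six, Matrix.cons_val, one_pow, mul_one, h4, ← pow_mul, ← pow_add]
    · rw [hL, hL, ← hD.map_smul]
      refine invariant_eq_of_intertwine F.2 !![2, 0; 0, 1] (by simp) _ _ ?_ ?_
      · ext i j; fin_cases i <;> fin_cases j <;> simp [Matrix.mul_apply] <;> ring
      · ext i j; fin_cases i <;> fin_cases j <;> simp [Matrix.mul_apply] <;> ring
  let σ : Equiv.Perm (Fin 6) := Equiv.swap 2 3 * Equiv.swap 4 5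
  have hswap : MvPolynomial.rename σ (L F) = L F := by
    refine MvPolynomial.funext fun z => ?_
    rw [MvPolynomial.eval_rename, hL, hL]
    refine invariant_eq_of_intertwine F.2 !![0, 1; 1, 0] (by simp) _ _ ?_ ?_
    · ext i j; fin_cases i <;> fin_cases j <;> simp [Matrix.mul_apply, σ, Equiv.swap_apply_def]
    · ext i j; fin_cases i <;> fin_cases j <;> simp [Matrix.mul_apply, σ, Equiv.swap_apply_def]
  have hzero : L F = 0 := by
    have hle : ∀ d : Fin 6 →₀ ℕ, d 3 ≤ d 2 → (L F).coeff d = 0 := by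
      intro d h3
      by_contra hd
      have h1 := hdeg d hd
      have h2 := htor d hd
      obtain ⟨l, hl, rfl⟩ := exists_leadingExponent_eq d h1 (by omega) h3
      exact hd (hcoeff l hl)
    ext d
    rw [MvPolynomial.coeff_zero]
    rcases le_total (d 3) (d 2) with h3 | h3
    · exact hle d h3
    · rw [← MvPolynomial.coeff_rename_mapDomain σ σ.injective, hswap]
      apply hle
      have e3 : (Finsupp.mapDomain σ d) 3 = d 2 := by
        rw [Finsupp.mapDomain_equiv_apply]; rfl
      have e2 : (Finsupp.mapDomain σ d) 2 = d 3 := by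
        rw [Finsupp.mapDomain_equiv_apply]; rfl
      rw [e3, e2]
      exact h3
  refine Subtype.ext (invariant_eq_zero F.2 fun a b x y t s => ?_)
  have h := hL F ![a, b, x, y, t, s]
  rw [hzero, map_zero] at h
  simpa using h.symm

section LowerBound

variable {K : Type} [Field K]

/-- The five basic invariants of a pair of `2 × 2` matrices: half the traces, and the
polarised determinants of the trace-free parts. -/
def basicInvariant (u : MatPair K) : Fin 5 → K :=
  ![u.1.trace * 2⁻¹, u.2.trace * 2⁻¹, u.1.trace * 2⁻¹ * (u.1.trace * 2⁻¹) - u.1.det,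
    u.2.trace * 2⁻¹ * (u.2.trace * 2⁻¹) - u.2.det,
    (u.1 * u.2).trace - u.1.trace * 2⁻¹ * u.2.trace]

theorem basicInvariant_matConj (g : GL (Fin 2) K) (u : MatPair K) :
    basicInvariant (matConj K g u) = basicInvariant u := by
  have h : g.val * u.1 * g⁻¹.val * (g.val * u.2 * g⁻¹.val) = g.val * (u.1 * u.2) * g⁻¹.val := by
    simp only [mul_assoc, Units.inv_mul_cancel_left]
  simp only [basicInvariant, matConj, h, Matrix.trace_units_conj, Matrix.det_units_conj]

theorem isDiagonalForm_basicInvariant (i : Fin 5) :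
    IsDiagonalForm K (![1, 1, 2, 2, 2] i) fun u : MatPair K => basicInvariant u i := by
  let p₁ : MatPair K →ₗ[K] Matrix (Fin 2) (Fin 2) K := LinearMap.fst K _ _
  let p₂ : MatPair K →ₗ[K] Matrix (Fin 2) (Fin 2) K := LinearMap.snd K _ _
  let tr := Matrix.traceLinearMap (Fin 2) K K
  have hdet : IsDiagonalForm K 2 fun A : Matrix (Fin 2) (Fin 2) K => A.det := by
    simp only [Matrix.det_fin_two]
    have h (i j : Fin 2) := IsDiagonalForm.of_linear (Matrix.entryLinearMap K K i j)
    exact ((h 0 0).mul (h 1 1)).sub ((h 0 1).mul (h 1 0))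
  have htr₁ := IsDiagonalForm.of_linear (tr ∘ₗ p₁)
  have htr₂ := IsDiagonalForm.of_linear (tr ∘ₗ p₂)
  have hhalf₁ := IsDiagonalForm.of_linear (LinearMap.mulRight K (2⁻¹ : K) ∘ₗ tr ∘ₗ p₁)
  have hhalf₂ := IsDiagonalForm.of_linear (LinearMap.mulRight K (2⁻¹ : K) ∘ₗ tr ∘ₗ p₂)
  have htr₁₂ : IsDiagonalForm K 2 fun u : MatPair K => (u.1 * u.2).trace := by
    have h₁ (i j : Fin 2) := IsDiagonalForm.of_linear (Matrix.entryLinearMap K K i j ∘ₗ p₁)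
    have h₂ (i j : Fin 2) := IsDiagonalForm.of_linear (Matrix.entryLinearMap K K i j ∘ₗ p₂)
    simp only [Matrix.trace_fin_two, Matrix.mul_apply, Fin.sum_univ_two]
    exact (((h₁ 0 0).mul (h₂ 0 0)).add ((h₁ 0 1).mul (h₂ 1 0))).add
      (((h₁ 1 0).mul (h₂ 0 1)).add ((h₁ 1 1).mul (h₂ 1 1)))
  fin_cases i
  · exact hhalf₁
  · exact hhalf₂
  · exact (hhalf₁.mul hhalf₁).sub (hdet.comp p₁)
  · exact (hhalf₂.mul hhalf₂).sub (hdet.comp p₂)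
  · exact htr₁₂.sub (hhalf₁.mul htr₂)

/-- The monomial in the basic invariants attached to an exponent vector. -/
def invariantMonomial (l : Fin 5 →₀ ℕ) (u : MatPair K) : K :=
  basicInvariant u 0 ^ l 0 * basicInvariant u 1 ^ l 1 * basicInvariant u 2 ^ (l 2 / 2) *
    basicInvariant u 3 ^ (l 3 / 2) * basicInvariant u 4 ^ (l 4 / 2)

theorem invariantMonomial_mem {n : ℕ} {l : Fin 5 →₀ ℕ} (hl : l ∈ evenExponents n) :
    invariantMonomial l ∈ invariantPolynomials K (matConj K) n := by
  refine ⟨?_, fun g u => by simp only [invariantMonomial, basicInvariant_matConj]⟩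
  have h (i : Fin 5) (k : ℕ) := (isDiagonalForm_basicInvariant (K := K) i).pow k
  have hprod := ((((h 0 (l 0)).mul (h 1 (l 1))).mul (h 2 (l 2 / 2))).mul (h 3 (l 3 / 2))).mul
    (h 4 (l 4 / 2))
  obtain ⟨hn, h2, h3, h4⟩ := mem_evenExponents.mp hl
  simp only [Matrix.cons_val, one_mul, Nat.two_mul_div_two_of_even h2,
    Nat.two_mul_div_two_of_even h3, Nat.two_mul_div_two_of_even h4, hn] at hprod
  exact hprod

variable [CharZero K]

theorem basicInvariant_section (z : Fin 5 → K) :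
    basicInvariant (!![z 0, z 2 ^ 2; 1, z 0], !![z 1 + z 3, z 4 ^ 2; 0, z 1 - z 3]) =
      ![z 0, z 1, z 2 ^ 2, z 3 ^ 2, z 4 ^ 2] := by
  ext i
  fin_cases i <;> simp [basicInvariant, Matrix.trace_fin_two, Matrix.det_fin_two] <;>
    field_simp <;> ring

theorem linearIndependent_invariantMonomial (K : Type) [Field K] [CharZero K] (n : ℕ) :
    LinearIndependent K fun l : evenExponents n =>
      (⟨invariantMonomial l.1, invariantMonomial_mem l.2⟩ :
        invariantPolynomials K (matConj K) n) := by
  rw [Fintype.linearIndependent_iff]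
  intro c hc l
  have hf : ∑ l : evenExponents n, MvPolynomial.monomial l.1 (c l) = 0 := by
    refine MvPolynomial.funext fun z => ?_
    have h := congrFun (congrArg Subtype.val hc)
      (!![z 0, z 2 ^ 2; 1, z 0], !![z 1 + z 3, z 4 ^ 2; 0, z 1 - z 3])
    rw [AddSubmonoidClass.coe_finsetSum, Finset.sum_apply] at h
    rw [map_sum, map_zero]
    refine Eq.trans (Finset.sum_congr rfl fun l _ => ?_) h
    obtain ⟨-, h2, h3, h4⟩ := mem_evenExponents.mp l.2
    rw [MvPolynomial.eval_monomial, Finsupp.prod_fintype _ _ (by simp)]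
    change _ = c l * invariantMonomial l.1 _
    rw [invariantMonomial, basicInvariant_section, Fin.prod_univ_five]
    simp only [Matrix.cons_val, ← pow_mul, Nat.two_mul_div_two_of_even h2,
      Nat.two_mul_div_two_of_even h3, Nat.two_mul_div_two_of_even h4]
  have h := congrArg (MvPolynomial.coeff l.1) hf
  simpa [MvPolynomial.coeff_sum, MvPolynomial.coeff_monomial, Subtype.coe_inj] using h

end LowerBound

theorem finrank_matConj (K : Type) [Field K] [CharZero K] (n : ℕ) :
    Module.finrank K (invariantPolynomials K (matConj K) n) = (evenExponents n).card := by
  obtain ⟨T, hT⟩ := exists_injective_coefficients K n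
  have : Module.Finite K (invariantPolynomials K (matConj K) n) := Module.Finite.of_injective T hT
  apply le_antisymm
  · simpa using LinearMap.finrank_le_finrank_of_injective hT
  · simpa using (linearIndependent_invariantMonomial K n).fintype_card_le_finrank

/-- For `dim W = 2` and `k = 2`, the Hilbert series of `K[End(W) ⊕ End(W)]^{GL(W)}` is
`1/((1−x²)³(1−x)²)`; stated by multiplying both sides with the denominator, which is
invertible in `ℤ[[x]]`. -/
theorem stmt18 (K : Type) [Field K] [CharZero K] (W : Type) [AddCommGroup W] [Module K W]
    (hW : Module.finrank K W = 2) :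
    (PowerSeries.mk fun n =>
        (Module.finrank K (invariantPolynomials K (conjAction K W 2) n) : ℤ)) *
      ((1 - X ^ 2) ^ 3 * (1 - X) ^ 2) = 1 := by
  simp only [finrank_conjAction_eq hW, finrank_matConj]
  exact mk_card_evenExponents_mul
end
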